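/- arXiv:2406.08955 — 6 statements merged into one kernel-verified Lean document; each statement's English description precedes it below -/
import Mathlib

section
/- Let I be a nonempty finite set of individuals with n = |I|, and let t_a, t_b : I → ℝ be nonnegative talent profiles that are pluralistic, i.e., there exist i, j ∈ I with t_a(i) > t_b(i) and t_b(j) > t_a(j). Assume moreover that t_a(i) ≥ min_{j∈I} t_b(j) for every i ∈ I. Fix a budget R ∈ ℝ and set w_a* = (R + Σ_i t_a(i))/n and w̃ = (R + Σ_i max{t_a(i), t_b(i)})/n. Let V : ℝ × ℝ → ℝ be symmetric (V(x, y) = V(y, x) for all x, y), nondecreasing in its second argument, and strictly increasing in its first argument. Under the one-school-a policy individual i has wage vector (w_a*, t_b(i)); under the two-school policy individual i has wage vector (w̃, t_b(i)) if t_a(i) ≥ t_b(i) and (t_a(i), w̃) otherwise. Then min_{i∈I} V(two-school wage vector of i) > min_{i∈I} V(w_a*, t_b(i)); that is, the two-school policy yields a strictly higher maximin social welfare than the one-school policy in sector a. -/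
/-- For a pluralistic distribution of talents (with every sector-a talent at
least the smallest sector-b talent), the two-school policy yields a strictly
higher maximin social welfare than the one-school policy in sector a, for any
freedom evaluation function `V` that is symmetric, nondecreasing in its
second argument and strictly increasing in its first argument. -/
theorem two_school_beats_one_school_maximin
    {ι : Type*} [Fintype ι] [Nonempty ι]
    (t_a t_b : ι → ℝ)
    (h_nonneg_a : ∀ i, 0 ≤ t_a i) (h_nonneg_b : ∀ i, 0 ≤ t_b i)
    (h_plural : ∃ i j : ι, t_b i < t_a i ∧ t_a j < t_b j)
    (h_min : ∀ i, Finset.univ.inf' Finset.univ_nonempty t_b ≤ t_a i)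
    (R : ℝ)
    (n : ℕ) (hn : n = Fintype.card ι)
    (wa : ℝ) (hwa : wa = (R + ∑ i, t_a i) / n)
    (wt : ℝ) (hwt : wt = (R + ∑ i, max (t_a i) (t_b i)) / n)
    (V : ℝ → ℝ → ℝ)
    (h_symm : ∀ x y, V x y = V y x)
    (h_mono_snd : ∀ x : ℝ, Monotone (V x))
    (h_strict_fst : ∀ y : ℝ, StrictMono (fun x => V x y)) :
    Finset.univ.inf' Finset.univ_nonempty
        (fun i => V wa (t_b i)) <
      Finset.univ.inf' Finset.univ_nonempty
        (fun i => if t_b i ≤ t_a i then V wt (t_b i) else V (t_a i) wt) := by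
  obtain ⟨-, j, -, hj⟩ := h_plural
  have hw : wa < wt := by
    rw [hwa, hwt, hn]
    have hsum : ∑ i, t_a i < ∑ i, max (t_a i) (t_b i) :=
      Finset.sum_lt_sum (fun i _ => le_max_left _ _)
        ⟨j, Finset.mem_univ j, lt_max_of_lt_right hj⟩
    have hcard : (0 : ℝ) < Fintype.card ι := Nat.cast_pos.mpr Fintype.card_pos
    gcongr
  obtain ⟨k, -, hk⟩ :=
    Finset.exists_mem_eq_inf' (Finset.univ_nonempty (α := ι)) t_b
  have key : ∀ x, t_b k ≤ x → V wa (t_b k) < V wt x := fun x hx =>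
    (h_mono_snd wa hx).trans_lt (h_strict_fst x hw)
  refine (Finset.inf'_le _ (Finset.mem_univ k)).trans_lt ?_
  rw [Finset.lt_inf'_iff]
  intro i _
  split_ifs
  · exact key _ (hk ▸ Finset.inf'_le t_b (Finset.mem_univ i))
  · rw [h_symm (t_a i)]
    exact key _ (hk ▸ h_min i)
end

section
/- Let V : ℝ × ℝ → ℝ be quasiconvex on ℝ² (for all p, q ∈ ℝ² and λ ∈ [0,1], V(λ·p + (1−λ)·q) ≤ max{V(p), V(q)}) and symmetric (V(x, y) = V(y, x) for all x, y). Then for all real numbers t_a ≥ t_b and every e ≥ 0, V(t_a, t_b + e) ≤ V(t_a + e, t_b); that is, adding a given educational investment e to the larger talent yields at least as high a freedom evaluation as adding it to the smaller talent. -/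
/-- For a symmetric and quasiconvex freedom evaluation function `V`, adding a
given educational investment `e ≥ 0` to the larger talent yields at least as
high a freedom evaluation as adding it to the smaller talent:
`V(t_a, t_b + e) ≤ V(t_a + e, t_b)` whenever `t_a ≥ t_b`. -/
theorem invest_in_larger_talent
    (V : ℝ × ℝ → ℝ)
    (h_qc : ∀ p q : ℝ × ℝ, ∀ lam : ℝ, 0 ≤ lam → lam ≤ 1 →
      V (lam • p + (1 - lam) • q) ≤ max (V p) (V q))
    (h_symm : ∀ x y : ℝ, V (x, y) = V (y, x))
    (t_a t_b e : ℝ) (h_tal : t_b ≤ t_a) (he : 0 ≤ e) :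
    V (t_a, t_b + e) ≤ V (t_a + e, t_b) := by
  rcases he.eq_or_lt with rfl | he
  · simp
  have hd : 0 < t_a - t_b + e := by linarith
  have h := h_qc (t_a + e, t_b) (t_b, t_a + e) ((t_a - t_b) / (t_a - t_b + e))
    (div_nonneg (by linarith) hd.le) ((div_le_one hd).2 (by linarith))
  rw [h_symm t_b, max_self] at h
  convert h using 2
  ext
  · simp
    field_simp
    ring
  · simp
    field_simp
    ring
end

section
/- Let V : ℝ × ℝ → ℝ be strictly quasiconvex on ℝ² (for all p ≠ q in ℝ² and λ ∈ (0,1), V(λ·p + (1−λ)·q) < max{V(p), V(q)}) and symmetric (V(x, y) = V(y, x) for all x, y). Then for all real numbers t_a > t_b and every e > 0, V(t_a, t_b + e) < V(t_a + e, t_b); that is, adding a given positive educational investment e to the strictly larger talent yields a strictly higher freedom evaluation than adding it to the smaller talent. -/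
/-- For a symmetric and strictly quasiconvex freedom evaluation function `V`,
adding a positive educational investment `e > 0` to the strictly larger
talent yields a strictly higher freedom evaluation than adding it to the
smaller talent: `V(t_a, t_b + e) < V(t_a + e, t_b)` whenever `t_a > t_b`. -/
theorem invest_in_larger_talent_strict
    (V : ℝ × ℝ → ℝ)
    (h_sqc : ∀ p q : ℝ × ℝ, p ≠ q → ∀ lam : ℝ, 0 < lam → lam < 1 →
      V (lam • p + (1 - lam) • q) < max (V p) (V q))
    (h_symm : ∀ x y : ℝ, V (x, y) = V (y, x))
    (t_a t_b e : ℝ) (h_tal : t_b < t_a) (he : 0 < e) :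
    V (t_a, t_b + e) < V (t_a + e, t_b) := by
  have hd : 0 < t_a + e - t_b := by linarith
  have hne : ((t_a + e, t_b) : ℝ × ℝ) ≠ (t_b, t_a + e) := fun h => by
    have := congrArg Prod.fst h
    simp only at this
    linarith
  have key := h_sqc _ _ hne ((t_a - t_b) / (t_a + e - t_b))
    (div_pos (by linarith) hd) ((div_lt_one hd).2 (by linarith))
  have hcomb : ((t_a - t_b) / (t_a + e - t_b)) • ((t_a + e, t_b) : ℝ × ℝ)
      + (1 - (t_a - t_b) / (t_a + e - t_b)) • ((t_b, t_a + e) : ℝ × ℝ)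
      = (t_a, t_b + e) := by
    ext <;> simp only [Prod.smul_mk, Prod.mk_add_mk, smul_eq_mul] <;>
      field_simp [hd.ne'] <;> ring
  rwa [hcomb, h_symm t_b, max_self] at key
end

section
/- Let V : ℝ × ℝ → ℝ be quasiconvex on ℝ² (for all p, q ∈ ℝ² and λ ∈ [0,1], V(λ·p + (1−λ)·q) ≤ max{V(p), V(q)}) and symmetric (V(x, y) = V(y, x) for all x, y). Fix real numbers t_a ≥ t_b and a target welfare level k ∈ ℝ. Then every e ≥ 0 with V(t_a, t_b + e) ≥ k also satisfies V(t_a + e, t_b) ≥ k; consequently, the infimum cost of reaching level k by investing in the larger-talent sector, inf{e ≥ 0 : V(t_a + e, t_b) ≥ k}, is at most the infimum cost of reaching it by investing in the smaller-talent sector, inf{e ≥ 0 : V(t_a, t_b + e) ≥ k}. -/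
/-- For a symmetric and quasiconvex freedom evaluation function `V` and
talents `t_a ≥ t_b`, any investment `e ≥ 0` in the smaller-talent sector that
reaches the welfare level `k` also reaches it when invested in the
larger-talent sector; consequently the infimum cost of reaching level `k`
(computed in the extended reals, so that an unattainable level costs `⊤`) by
investing in the larger-talent sector is at most that of investing in the
smaller-talent sector. -/
theorem cheaper_to_invest_in_larger_talent
    (V : ℝ × ℝ → ℝ)
    (h_qc : ∀ p q : ℝ × ℝ, ∀ lam : ℝ, 0 ≤ lam → lam ≤ 1 →
      V (lam • p + (1 - lam) • q) ≤ max (V p) (V q))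
    (h_symm : ∀ x y : ℝ, V (x, y) = V (y, x))
    (t_a t_b : ℝ) (h_tal : t_b ≤ t_a) (k : ℝ) :
    (∀ e : ℝ, 0 ≤ e → k ≤ V (t_a, t_b + e) → k ≤ V (t_a + e, t_b)) ∧
    sInf ((fun e : ℝ => (e : EReal)) '' {e : ℝ | 0 ≤ e ∧ k ≤ V (t_a + e, t_b)})
      ≤ sInf ((fun e : ℝ => (e : EReal)) ''
          {e : ℝ | 0 ≤ e ∧ k ≤ V (t_a, t_b + e)}) := by
  have reach : ∀ e : ℝ, 0 ≤ e → k ≤ V (t_a, t_b + e) → k ≤ V (t_a + e, t_b) := by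
    intro e he hk
    rcases he.eq_or_lt with rfl | he
    · simpa using hk
    have hd : 0 < t_a - t_b + e := by linarith
    have h := h_qc (t_a + e, t_b) (t_b, t_a + e) ((t_a - t_b) / (t_a - t_b + e))
      (div_nonneg (by linarith) hd.le) ((div_le_one hd).2 (by linarith))
    rw [h_symm t_b, max_self] at h
    convert hk.trans (le_of_eq_of_le _ h) using 1
    congr 1
    ext <;> simp <;> field_simp <;> ring
  exact ⟨reach, sInf_le_sInf (Set.image_mono fun e he => ⟨he.1, reach e he.1 he.2⟩)⟩
end

section
/- Let V : ℝ × ℝ → ℝ be continuous, symmetric (V(x, y) = V(y, x) for all x, y), and strictly quasiconvex on ℝ² (for all p ≠ q in ℝ² and λ ∈ (0,1), V(λ·p + (1−λ)·q) < max{V(p), V(q)}). Fix real numbers t_a > t_b and a target welfare level k ∈ ℝ, and suppose the cost of reaching level k by investing in the smaller-talent sector, c_b := inf{e ≥ 0 : V(t_a, t_b + e) ≥ k}, satisfies 0 < c_b < ∞ (the set {e ≥ 0 : V(t_a, t_b + e) ≥ k} is nonempty and its infimum is positive). Then the cost of reaching level k by investing in the larger-talent sector is strictly smaller: inf{e ≥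 0 : V(t_a + e, t_b) ≥ k} < c_b. -/
/-- A symmetric, strictly quasiconvex function is strictly larger at a more spread-out pair of
coordinates with the same sum. -/
theorem lt_of_symm_of_strictQuasiconvex {V : ℝ × ℝ → ℝ}
    (h_symm : ∀ x y : ℝ, V (x, y) = V (y, x))
    (h_sqc : ∀ p q : ℝ × ℝ, p ≠ q → ∀ lam : ℝ, 0 < lam → lam < 1 →
      V (lam • p + (1 - lam) • q) < max (V p) (V q))
    {a b c : ℝ} (hab : b < a) (hc : 0 < c) : V (a, b + c) < V (a + c, b) := by
  have hd : 0 < a + c - b := by linarith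
  have h := h_sqc (a + c, b) (b, a + c)
    (fun h => by have := congrArg Prod.fst h; simp only at this; linarith)
    ((a - b) / (a + c - b)) (div_pos (by linarith) hd) ((div_lt_one hd).2 (by linarith))
  rw [h_symm b (a + c), max_self] at h
  convert h using 2
  ext <;> simp only [Prod.smul_mk, Prod.mk_add_mk, smul_eq_mul] <;> field_simp <;> ring

/-- For a continuous, symmetric and strictly quasiconvex freedom evaluation
function `V` and talents `t_a > t_b`, if the cost `c_b` of reaching the
welfare level `k` by investing in the smaller-talent sector is finite and
positive (the feasible set is nonempty and its infimum is positive), then the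
cost of reaching level `k` by investing in the larger-talent sector is
strictly smaller. -/
theorem strictly_cheaper_to_invest_in_larger_talent
    (V : ℝ × ℝ → ℝ)
    (h_cont : Continuous V)
    (h_symm : ∀ x y : ℝ, V (x, y) = V (y, x))
    (h_sqc : ∀ p q : ℝ × ℝ, p ≠ q → ∀ lam : ℝ, 0 < lam → lam < 1 →
      V (lam • p + (1 - lam) • q) < max (V p) (V q))
    (t_a t_b : ℝ) (h_tal : t_b < t_a) (k : ℝ)
    (h_ne : {e : ℝ | 0 ≤ e ∧ k ≤ V (t_a, t_b + e)}.Nonempty)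
    (h_pos : 0 < sInf {e : ℝ | 0 ≤ e ∧ k ≤ V (t_a, t_b + e)}) :
    sInf {e : ℝ | 0 ≤ e ∧ k ≤ V (t_a + e, t_b)} <
      sInf {e : ℝ | 0 ≤ e ∧ k ≤ V (t_a, t_b + e)} := by
  set S := {e : ℝ | 0 ≤ e ∧ k ≤ V (t_a, t_b + e)}
  have hS_closed : IsClosed S :=
    isClosed_Ici.inter (isClosed_Ici.preimage (by fun_prop : Continuous fun e => V (t_a, t_b + e)))
  have hS_mem : sInf S ∈ S := hS_closed.csInf_mem h_ne ⟨0, fun _ he => he.1⟩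
  have h_gt : k < V (t_a + sInf S, t_b) :=
    hS_mem.2.trans_lt (lt_of_symm_of_strictQuasiconvex h_symm h_sqc h_tal h_pos)
  have h_open : IsOpen {e : ℝ | k < V (t_a + e, t_b)} :=
    isOpen_lt continuous_const (by fun_prop)
  obtain ⟨l, hl, hl_sub⟩ := exists_Ioc_subset_of_mem_nhds (h_open.mem_nhds h_gt) ⟨0, h_pos⟩
  obtain ⟨e, he, he_lt⟩ := exists_between (max_lt hl h_pos)
  have he_val : k < V (t_a + e, t_b) := hl_sub ⟨(le_max_left l 0).trans_lt he, he_lt.le⟩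
  have he_mem : e ∈ {e : ℝ | 0 ≤ e ∧ k ≤ V (t_a + e, t_b)} :=
    ⟨(le_max_right l 0).trans he.le, he_val.le⟩
  exact (csInf_le ⟨0, fun _ hx => hx.1⟩ he_mem).trans_lt he_lt
end

section
/- Let I be a nonempty finite set of individuals, t_a, t_b : I → ℝ talent profiles, and V : ℝ × ℝ → ℝ quasiconvex on ℝ² (for all p, q ∈ ℝ² and λ ∈ [0,1], V(λ·p + (1−λ)·q) ≤ max{V(p), V(q)}) and symmetric (V(x, y) = V(y, x) for all x, y). Fix a budget R ≥ 0 and a welfare level k ∈ ℝ. Suppose the one-school-a policy can bring everyone to level k within budget: there exists e : I → ℝ with e(i) ≥ 0 for all i, Σ_{i∈I} e(i) ≤ R, and V(t_a(i) + e(i), t_b(i)) ≥ k for every i. Then the two-school policy can do the same within the same budget: there exists e' : I → ℝ with e'(i) ≥ 0 for all i, Σ_{i∈I} e'(i) ≤ R, such that for every i, V(t_a(i) + e'(i), t_b(i)) ≥ k if t_a(i) ≥ t_b(i), and V(t_a(i), t_b(i) + e'(i)) ≥ k otherwise. Consequently, the supremum of common expected-utility levels attainable under the two-school policy with budget R is at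 least that attainable under the one-school policy in sector a (and, by symmetry, in sector b). -/
/-- For a symmetric quasiconvex function of two wages, adding `e ≥ 0` to the larger wage yields at
least as much as adding it to the smaller one. -/
theorem le_of_symmetric_quasiconvex {V : ℝ × ℝ → ℝ}
    (h_qc : ∀ p q : ℝ × ℝ, ∀ lam : ℝ, 0 ≤ lam → lam ≤ 1 →
      V (lam • p + (1 - lam) • q) ≤ max (V p) (V q))
    (h_symm : ∀ x y : ℝ, V (x, y) = V (y, x))
    {x y e : ℝ} (hxy : x < y) (he : 0 ≤ e) :
    V (x + e, y) ≤ V (x, y + e) := by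
  have hd : 0 < y + e - x := by linarith
  have h := h_qc (x, y + e) (y + e, x) ((y - x) / (y + e - x))
    (div_nonneg (by linarith) hd.le) ((div_le_one hd).2 (by linarith))
  have hcomb : ((y - x) / (y + e - x)) • (x, y + e) +
      (1 - (y - x) / (y + e - x)) • (y + e, x) = (x + e, y) := by
    ext <;> simp only [Prod.smul_mk, Prod.mk_add_mk, smul_eq_mul] <;>
      field_simp [hd.ne'] <;> ring
  rwa [hcomb, h_symm (y + e) x, max_self] at h


/-- For a symmetric, quasiconvex freedom evaluation function `V`: whatever
common welfare level `k` the one-school-a policy can bring every individual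
to within the budget `R`, the two-school policy (investing, for each
individual, in the sector of his/her greater talent) can also attain within
the same budget; consequently the supremum (in the extended reals) of common
levels attainable by the two-school policy is at least that attainable by the
one-school policy in sector a. -/
theorem two_school_attains_any_one_school_level
    {ι : Type*} [Fintype ι] [Nonempty ι]
    (t_a t_b : ι → ℝ)
    (V : ℝ × ℝ → ℝ)
    (h_qc : ∀ p q : ℝ × ℝ, ∀ lam : ℝ, 0 ≤ lam → lam ≤ 1 →
      V (lam • p + (1 - lam) • q) ≤ max (V p) (V q))
    (h_symm : ∀ x y : ℝ, V (x, y) = V (y, x))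
    (R : ℝ) (hR : 0 ≤ R) :
    (∀ k : ℝ,
      (∃ e : ι → ℝ, (∀ i, 0 ≤ e i) ∧ (∑ i, e i) ≤ R ∧
        ∀ i, k ≤ V (t_a i + e i, t_b i)) →
      (∃ e' : ι → ℝ, (∀ i, 0 ≤ e' i) ∧ (∑ i, e' i) ≤ R ∧
        ∀ i, (t_b i ≤ t_a i → k ≤ V (t_a i + e' i, t_b i)) ∧
             (¬ t_b i ≤ t_a i → k ≤ V (t_a i, t_b i + e' i)))) ∧
    sSup ((fun k : ℝ => (k : EReal)) ''
        {k : ℝ | ∃ e : ι → ℝ, (∀ i, 0 ≤ e i) ∧ (∑ i, e i) ≤ R ∧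
          ∀ i, k ≤ V (t_a i + e i, t_b i)})
      ≤ sSup ((fun k : ℝ => (k : EReal)) ''
        {k : ℝ | ∃ e' : ι → ℝ, (∀ i, 0 ≤ e' i) ∧ (∑ i, e' i) ≤ R ∧
          ∀ i, (t_b i ≤ t_a i → k ≤ V (t_a i + e' i, t_b i)) ∧
               (¬ t_b i ≤ t_a i → k ≤ V (t_a i, t_b i + e' i))}) := by
  have key : ∀ k : ℝ,
      (∃ e : ι → ℝ, (∀ i, 0 ≤ e i) ∧ (∑ i, e i) ≤ R ∧
        ∀ i, k ≤ V (t_a i + e i, t_b i)) →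
      (∃ e' : ι → ℝ, (∀ i, 0 ≤ e' i) ∧ (∑ i, e' i) ≤ R ∧
        ∀ i, (t_b i ≤ t_a i → k ≤ V (t_a i + e' i, t_b i)) ∧
             (¬ t_b i ≤ t_a i → k ≤ V (t_a i, t_b i + e' i))) := by
    rintro k ⟨e, he, hsum, hk⟩
    exact ⟨e, he, hsum, fun i => ⟨fun _ => hk i, fun hlt =>
      (hk i).trans (le_of_symmetric_quasiconvex h_qc h_symm (not_le.1 hlt) (he i))⟩⟩
  exact ⟨key, sSup_le_sSup (Set.image_mono key)⟩
end
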